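/- arXiv:2101.03824 — 8 statements merged into one kernel-verified Lean document; each statement's English description precedes it below -/
import Mathlib

section
/- Let Γ be a subgroup of SL₂(ℤ) containing −I. If there exists a 1-cocycle φ : Γ → ℤ² that is not a coboundary, then there exists a nonzero vector w ∈ (ℤ/2ℤ)² such that the mod-2 reduction of every element of Γ fixes w. -/
open Matrix

/-- `SL₂(ℤ)`. -/
abbrev SL2Z := Matrix.SpecialLinearGroup (Fin 2) ℤ

/-- `φ : Γ → ℤ²` is a 1-cocycle for the action of `Γ ≤ SL₂(ℤ)` on `ℤ²` by
matrix–vector multiplication: `φ(gh) = φ(g) + g·φ(h)`. -/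
def IsCocycle (Γ : Subgroup SL2Z) (φ : Γ → Fin 2 → ℤ) : Prop :=
  ∀ g h : Γ, φ (g * h) = φ g + ((g : SL2Z) : Matrix (Fin 2) (Fin 2) ℤ) *ᵥ φ h

/-- `φ : Γ → ℤ²` is a coboundary: `φ(g) = g·v − v` for some fixed `v ∈ ℤ²`. -/
def IsCoboundary (Γ : Subgroup SL2Z) (φ : Γ → Fin 2 → ℤ) : Prop :=
  ∃ v : Fin 2 → ℤ, ∀ g : Γ, φ g = ((g : SL2Z) : Matrix (Fin 2) (Fin 2) ℤ) *ᵥ v - v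

/-- Reduction of the entries of an element of `SL₂(ℤ)` modulo 2, giving a
matrix over `ℤ/2ℤ`. -/
def redMod2 (g : SL2Z) : Matrix (Fin 2) (Fin 2) (ZMod 2) :=
  (g : Matrix (Fin 2) (Fin 2) ℤ).map (Int.cast : ℤ → ZMod 2)

/-- Comparing the two expansions of `φ(-g)` expresses `2φ(g)` through the value of `φ` at `-I`. -/
theorem IsCocycle.sub_mulVec_neg_one {Γ : Subgroup SL2Z} {φ : Γ → Fin 2 → ℤ}
    (hφ : IsCocycle Γ φ) (hneg : (-1 : SL2Z) ∈ Γ) (g : Γ) :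
    φ ⟨-1, hneg⟩ - ((g : SL2Z) : Matrix (Fin 2) (Fin 2) ℤ) *ᵥ φ ⟨-1, hneg⟩ =
      (2 : ℤ) • φ g := by
  have hcomm : g * ⟨-1, hneg⟩ = ⟨-1, hneg⟩ * g := Subtype.ext (by simp)
  have h := hφ g ⟨-1, hneg⟩
  rw [hcomm, hφ] at h
  have hcoe : ((-1 : SL2Z) : Matrix (Fin 2) (Fin 2) ℤ) = -1 := by
    rw [SpecialLinearGroup.coe_neg]; rfl
  rw [hcoe, neg_mulVec, one_mulVec] at h
  rw [two_smul, sub_eq_iff_eq_add, add_assoc, ← sub_eq_iff_eq_add', ← h]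
  abel

theorem redMod2_mulVec_intCast (g : SL2Z) (v : Fin 2 → ℤ) (i : Fin 2) :
    (redMod2 g *ᵥ fun j => (v j : ZMod 2)) i =
      (((g : Matrix (Fin 2) (Fin 2) ℤ) *ᵥ v) i : ℤ) :=
  (RingHom.map_mulVec (Int.castRingHom (ZMod 2)) (g : Matrix (Fin 2) (Fin 2) ℤ) v i).symm

/-- If `Γ ≤ SL₂(ℤ)` contains `-I` and there is a 1-cocycle `φ : Γ → ℤ²` that is
not a coboundary, then there is a nonzero `w ∈ (ℤ/2ℤ)²` fixed by the mod-2
reduction of every element of `Γ`. -/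
theorem exists_fixed_mod_two_vector_of_noncoboundary (Γ : Subgroup SL2Z)
    (hneg : (-1 : SL2Z) ∈ Γ) (φ : Γ → Fin 2 → ℤ)
    (hφ : IsCocycle Γ φ) (hnb : ¬ IsCoboundary Γ φ) :
    ∃ w : Fin 2 → ZMod 2, w ≠ 0 ∧ ∀ g : SL2Z, g ∈ Γ → redMod2 g *ᵥ w = w := by
  refine ⟨fun i => (φ ⟨-1, hneg⟩ i : ZMod 2), fun hw => hnb ?_, fun g hg => funext fun i => ?_⟩
  · have hdvd (i : Fin 2) : (2 : ℤ) ∣ φ ⟨-1, hneg⟩ i :=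
      (ZMod.intCast_zmod_eq_zero_iff_dvd _ 2).mp (congrFun hw i)
    choose u hu using hdvd
    have hu' : φ ⟨-1, hneg⟩ = (2 : ℤ) • u := funext hu
    refine ⟨-u, fun g => smul_right_injective _ (two_ne_zero (α := ℤ)) ?_⟩
    have h := hφ.sub_mulVec_neg_one hneg g
    rw [hu', mulVec_smul, ← smul_sub] at h
    simp only [← h, mulVec_neg, sub_neg_eq_add, neg_add_eq_sub]
  · have h := congrFun (hφ.sub_mulVec_neg_one hneg ⟨g, hg⟩) i
    rw [redMod2_mulVec_intCast]
    refine ((ZMod.intCast_eq_intCast_iff_dvd_sub _ _ 2).mpr ?_)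
    exact ⟨_, h⟩
end

section
/- SL₂(ℤ) has exactly one subgroup of index 2, and this subgroup contains the matrix −I. -/
open ModularGroup Matrix.SpecialLinearGroup

/-- The sign of the permutation that a matrix induces on the three nonzero vectors of `𝔽₂²`,
written additively as a polynomial in the entries modulo 2. -/
def signMod2 : SL2Z →* Multiplicative (ZMod 2) :=
  MonoidHom.mk'
    (fun g ↦ Multiplicative.ofAdd
      ((g 0 0 * g 0 1 + g 0 1 * g 1 0 + g 1 0 * g 1 1 : ℤ) : ZMod 2)) (by
    intro g h
    have key : ∀ a b c d a' b' c' d' : ZMod 2, a * d - b * c = 1 → a' * d' - b' * c' = 1 →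
        (a * a' + b * c') * (a * b' + b * d') + (a * b' + b * d') * (c * a' + d * c') +
          (c * a' + d * c') * (c * b' + d * d') =
        (a * b + b * c + c * d) + (a' * b' + b' * c' + c' * d') := by decide
    have det_mod_two : ∀ k : SL2Z,
        (k 0 0 : ZMod 2) * (k 1 1 : ZMod 2) - (k 0 1 : ZMod 2) * (k 1 0 : ZMod 2) = 1 := by
      intro k
      have hk := k.det_coe
      rw [Matrix.det_fin_two] at hk
      exact_mod_cast congrArg (Int.cast : ℤ → ZMod 2) hk
    rw [← ofAdd_add]
    congr 1
    simp only [coe_mul, Matrix.mul_apply, Fin.sum_univ_two]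
    push_cast
    exact key _ _ _ _ _ _ _ _ (det_mod_two g) (det_mod_two h))

theorem index_ker_signMod2 : signMod2.ker.index = 2 := by
  have sign_T : signMod2 T = Multiplicative.ofAdd 1 := by decide
  rw [Subgroup.index_eq_two_iff]
  refine ⟨T, fun b ↦ ?_⟩
  rw [MonoidHom.mem_ker, MonoidHom.mem_ker, map_mul, sign_T]
  generalize signMod2 b = x
  revert x
  decide

theorem S_mul_T_mem_of_index_two {Γ : Subgroup SL2Z} (h : Γ.index = 2) : S * T ∈ Γ := by
  have cube_eq : S * T * (S * T) * (S * T) = S * S := by decide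
  have cube_mem : S * T * (S * T) * (S * T) ∈ Γ :=
    cube_eq ▸ Subgroup.mul_self_mem_of_index_two h S
  exact (Γ.mul_mem_cancel_left (Subgroup.mul_self_mem_of_index_two h (S * T))).1 cube_mem

theorem S_mem_iff_T_mem_of_index_two {Γ : Subgroup SL2Z} (h : Γ.index = 2) : S ∈ Γ ↔ T ∈ Γ :=
  (Subgroup.mul_mem_iff_of_index_two h).1 (S_mul_T_mem_of_index_two h)

theorem S_notMem_of_index_two {Γ : Subgroup SL2Z} (h : Γ.index = 2) : S ∉ Γ := by
  intro hS
  have hΓ : Γ = ⊤ := by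
    rw [eq_top_iff, ← SpecialLinearGroup.SL2Z_generators, Subgroup.closure_le]
    rintro g (rfl | rfl)
    exacts [hS, (S_mem_iff_T_mem_of_index_two h).1 hS]
  simp [hΓ] at h

theorem eq_of_index_two {Γ Δ : Subgroup SL2Z} (hΓ : Γ.index = 2) (hΔ : Δ.index = 2) :
    Γ = Δ := by
  have S_iff : S ∈ Γ ↔ S ∈ Δ := iff_of_false (S_notMem_of_index_two hΓ) (S_notMem_of_index_two hΔ)
  ext g
  have hg : g ∈ Subgroup.closure {S, T} := by simp [SpecialLinearGroup.SL2Z_generators]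
  induction hg using Subgroup.closure_induction with
  | mem x hx =>
    rcases hx with rfl | rfl
    · exact S_iff
    · rw [← S_mem_iff_T_mem_of_index_two hΓ, ← S_mem_iff_T_mem_of_index_two hΔ, S_iff]
  | one => simp
  | mul x y _ _ hx hy =>
    rw [Subgroup.mul_mem_iff_of_index_two hΓ, Subgroup.mul_mem_iff_of_index_two hΔ]
    exact iff_congr hx hy
  | inv x _ hx => simpa using hx

/-- `SL₂(ℤ)` has exactly one subgroup of index 2, and this subgroup contains
the matrix `-I`. -/
theorem unique_index_two_subgroup_SL2Z :
    (∃! Γ : Subgroup SL2Z, Γ.index = 2) ∧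
    (∀ Γ : Subgroup SL2Z, Γ.index = 2 → (-1 : SL2Z) ∈ Γ) := by
  refine ⟨⟨signMod2.ker, index_ker_signMod2, fun Γ h ↦ eq_of_index_two h index_ker_signMod2⟩,
    fun Γ h ↦ ?_⟩
  have S_sq : S * S = -1 := by decide
  exact S_sq ▸ Subgroup.mul_self_mem_of_index_two h S
end

section
/- If Γ is a subgroup of SL₂(ℤ) of index 2, then every 1-cocycle φ : Γ → ℤ² is a coboundary; that is, H¹(Γ; ℤ²) = 0 for the restriction to Γ of the standard action of SL₂(ℤ) on ℤ². -/
open Matrix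

/-- Since `-1` is central, a cocycle is determined up to a factor `2` by its value at `-1`. -/
lemma IsCocycle.two_smul_eq {Γ : Subgroup SL2Z} {φ : Γ → Fin 2 → ℤ} (hφ : IsCocycle Γ φ)
    (hneg : (-1 : SL2Z) ∈ Γ) (g : Γ) :
    (2 : ℤ) • φ g = φ ⟨-1, hneg⟩ - ((g : SL2Z) : Matrix (Fin 2) (Fin 2) ℤ) *ᵥ φ ⟨-1, hneg⟩ := by
  have hcomm : (⟨-1, hneg⟩ : Γ) * g = g * ⟨-1, hneg⟩ := Subtype.ext (by simp)
  have h := hφ ⟨-1, hneg⟩ g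
  rw [hcomm, hφ g ⟨-1, hneg⟩] at h
  have hval : ((-1 : SL2Z) : Matrix (Fin 2) (Fin 2) ℤ) = -1 := by decide
  rw [hval, neg_mulVec, one_mulVec] at h
  rw [two_smul, eq_sub_iff_add_eq, add_assoc, h]
  abel

/-- If `Γ ≤ SL₂(ℤ)` has index 2, then every 1-cocycle `φ : Γ → ℤ²` is a
coboundary; that is, `H¹(Γ; ℤ²) = 0`. -/
theorem h1_vanishes_of_index_two (Γ : Subgroup SL2Z) (hΓ : Γ.index = 2)
    (φ : Γ → Fin 2 → ℤ) (hφ : IsCocycle Γ φ) : IsCoboundary Γ φ := by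
  have hneg : (-1 : SL2Z) ∈ Γ := by
    have h := Subgroup.mul_self_mem_of_index_two hΓ ModularGroup.S
    rwa [show ModularGroup.S * ModularGroup.S = -1 by decide] at h
  let A : SL2Z := (ModularGroup.S * ModularGroup.T) * (ModularGroup.S * ModularGroup.T)
  have hA : A ∈ Γ := Subgroup.mul_self_mem_of_index_two hΓ _
  have hA' : (A : Matrix (Fin 2) (Fin 2) ℤ) = !![-1, -1; 1, 0] := by decide
  have key := hφ.two_smul_eq hneg
  set c := φ ⟨-1, hneg⟩
  -- `A` has order `3`, so `1 - A` has determinant `3` and is invertible modulo `2`.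
  obtain ⟨v, hv⟩ : ∃ v : Fin 2 → ℤ, c = (-2 : ℤ) • v := by
    have h0 := congrFun (key ⟨A, hA⟩) 0
    have h1 := congrFun (key ⟨A, hA⟩) 1
    simp [hA', dotProduct, Fin.sum_univ_two] at h0 h1
    refine ⟨![-(c 0 / 2), -(c 1 / 2)], ?_⟩
    ext i
    fin_cases i <;> simp <;> omega
  refine ⟨v, fun g => smul_right_injective (Fin 2 → ℤ) (two_ne_zero (α := ℤ)) ?_⟩
  change (2 : ℤ) • φ g = (2 : ℤ) • _
  rw [key g, hv, mulVec_smul]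
  module
end

section
/- For every integer m ≥ 4, the congruence subgroup Γ₁(m) of SL₂(ℤ) is a free group. -/
namespace Monoid.CoprodI

open CategoryTheory CategoryTheory.ActionCategory

universe u

variable {ι A : Type u} {G : ι → Type u} [∀ i, Group (G i)] [MulAction (CoprodI G) A]

theorem exists_factor_orbit_representatives (G : ι → Type u) (A : Type u)
    [∀ i, Group (G i)] [MulAction (CoprodI G) A] :
    ∃ (r : ι → A → A) (k : ∀ i, A → G i),
      (∀ (i) (g : G i) (a : A), r i ((of g : CoprodI G) • a) = r i a) ∧
      ∀ i a, (of (k i a) : CoprodI G) • r i a = a := by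
  let s (i : ι) : Setoid A :=
    { r a b := ∃ g : G i, (of g : CoprodI G) • a = b
      iseqv :=
        { refl a := ⟨1, by simp⟩
          symm := by
            rintro a _ ⟨g, rfl⟩
            exact ⟨g⁻¹, by simp⟩
          trans := by
            rintro a _ _ ⟨g, rfl⟩ ⟨g', rfl⟩
            exact ⟨g' * g, by simp [mul_smul]⟩ } }
  have hk (i : ι) (a : A) : ∃ g : G i, (of g : CoprodI G) • (Quotient.mk (s i) a).out = a :=
    Quotient.mk_out (s := s i) a
  choose k hk using hk
  refine ⟨fun i a => (Quotient.mk (s i) a).out, k, fun i g a => ?_, hk⟩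
  exact congrArg Quotient.out (Quotient.sound (s := s i) ⟨g⁻¹, by simp⟩)

/-- If every factor of a free product of groups acts freely on `A`, then the action groupoid is
free. It is generated by the arrows from a chosen representative of each orbit of each factor
to the other points of that orbit. -/
theorem nonempty_isFreeGroupoid_actionCategory
    (hfree : ∀ (i) (g : G i) (a : A), (of g : CoprodI G) • a = a → g = 1) :
    Nonempty (IsFreeGroupoid (ActionCategory (CoprodI G) A)) := by
  classical
  obtain ⟨r, k, hr, hk⟩ := exists_factor_orbit_representatives G A
  have hrr (i : ι) (a : A) : r i (r i a) = r i a := by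
    conv_rhs => rw [← hk i a]
    rw [hr]
  have hinj {i : ι} {g g' : G i} {a : A}
      (h : (of g : CoprodI G) • a = (of g' : CoprodI G) • a) : g = g' := by
    refine (inv_mul_eq_one.mp (hfree i _ a ?_)).symm
    rw [map_mul, mul_smul, h, map_inv, inv_smul_smul]
  refine ⟨{
    quiverGenerators :=
      ⟨fun a b => { i : ι // r i (ActionCategory.back b) = ActionCategory.back a ∧
        ActionCategory.back a ≠ ActionCategory.back b }⟩
    of := fun {a b} (e : Subtype _) => ⟨of (k e.1 (ActionCategory.back b)), by
      have := hk e.1 (ActionCategory.back b)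
      rw [e.2.1] at this
      exact this⟩
    unique_lift := ?_ }⟩
  intro X _ f
  let h (i : ι) (b : A) : X :=
    if hb : r i b = b then 1 else @f ⟨(), r i b⟩ ⟨(), b⟩ ⟨i, rfl, hb⟩
  have hh (i : ι) (b : A) : h i (r i b) = 1 := dif_pos (hrr i b)
  let φ (i : ι) : G i →* (A → X) ⋊[mulAutArrow] CoprodI G :=
    { toFun g := ⟨fun b => h i b * (h i ((of g : CoprodI G)⁻¹ • b))⁻¹, of g⟩
      map_one' := by
        ext b
        · simp
        · simp
      map_mul' g g' := by
        ext b
        · change h i b * _ = (h i b * _) * (h i ((of g : CoprodI G)⁻¹ • b) * _)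
          simp [mul_smul]
        · simp }
  have hright : SemidirectProduct.rightHom.comp (lift φ) = MonoidHom.id _ := by
    ext i g
    simp [φ]
  have hleft (i : ι) (b : A) : (lift φ (of (k i b))).left b = h i b := by
    have : (of (k i b) : CoprodI G)⁻¹ • b = r i b := by rw [inv_smul_eq_iff, hk]
    simp [φ, this, hh]
  refine ⟨uncurry (lift φ) fun g => DFunLike.congr_fun hright g, ?_, ?_⟩
  · rintro ⟨⟨⟩, a : A⟩ ⟨⟨⟩, b : A⟩ ⟨i, rfl : r i b = a, hne : r i b ≠ b⟩
    change (lift φ (of (k i b))).left b = _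
    rw [hleft]
    exact dif_neg hne
  · intro E hE
    have hmul (g g' : CoprodI G) (b : A) : (curry E (g * g')).left b =
        (curry E g).left b * (curry E g').left (g⁻¹ • b) := by
      rw [map_mul]
      rfl
    have hpair {g : CoprodI G} {a b : A} (hg : g • a = b) : (curry E g).left b =
        E.map (Subtype.mk g hg : @Quiver.Hom (ActionCategory (CoprodI G) A) _ ⟨(), a⟩ ⟨(), b⟩) := by
      obtain rfl : g⁻¹ • b = a := by rw [← hg, inv_smul_smul]
      rfl
    have hkE (i : ι) (b : A) : (curry E (of (k i b))).left b = h i b := by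
      by_cases hb : r i b = b
      · have : k i b = 1 := hfree i _ b (by simpa only [hb] using hk i b)
        have hb' : h i b = 1 := dif_pos hb
        rw [this, map_one, map_one, hb']
        rfl
      · refine Eq.trans ?_ (dif_neg hb).symm
        exact (hpair (hk i b)).trans (hE ⟨(), r i b⟩ ⟨(), b⟩ ⟨i, rfl, hb⟩)
    have hcurry : curry E = lift φ := by
      refine ext_hom _ _ fun i => ?_
      ext g b
      · have hg : g * k i ((of g : CoprodI G)⁻¹ • b) = k i b := by
          apply hinj (a := r i b)
          have := hk i ((of g : CoprodI G)⁻¹ • b)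
          rw [← map_inv, hr, map_inv] at this
          rw [hk, map_mul, mul_smul, this, smul_inv_smul]
        have key := hmul (of g) (of (k i ((of g : CoprodI G)⁻¹ • b))) b
        rw [← map_mul, hg, hkE, hkE] at key
        simp [φ, key]
      · rfl
    apply Functor.hext
    · intro
      apply Unit.ext
    · refine ActionCategory.cases ?_
      intro b g
      exact heq_of_eq (congrArg (fun F => (F g).left b) hcurry)

/-- A subgroup of a free product meeting every conjugate of every factor trivially is free. -/
theorem isFreeGroup_of_conj_notMem (H : Subgroup (CoprodI G))
    (hH : ∀ (i) (x : G i) (g : CoprodI G), g⁻¹ * of x * g ∈ H → x = 1) : IsFreeGroup H := by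
  have hfree (i : ι) (x : G i) (a : CoprodI G ⧸ H) (h : (of x : CoprodI G) • a = a) : x = 1 := by
    induction a using QuotientGroup.induction_on with
    | H g =>
      refine hH i x g ?_
      rw [MulAction.Quotient.smul_coe, eq_comm, QuotientGroup.eq] at h
      simpa [mul_assoc] using h
  obtain ⟨_⟩ := nonempty_isFreeGroupoid_actionCategory hfree
  have hconn : IsConnected (ActionCategory (CoprodI G) (CoprodI G ⧸ H)) := inferInstance
  have hfreeEnd := @IsFreeGroupoid.endIsFreeOfConnectedFree _ _ (by exact hconn) _
    (objEquiv (CoprodI G) (CoprodI G ⧸ H) ↑(1 : CoprodI G))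
  exact @IsFreeGroup.ofMulEquiv _ _ hfreeEnd _ _ (endMulEquivSubgroup H)

/-- The same criterion for subgroups of any group that receives an embedding of the free product. -/
theorem isFreeGroup_of_lift_injective {K Γ : Type u} [Group K] [Group Γ] (f : ∀ i, G i →* K)
    (hf : Function.Injective (lift f)) (ρ : Γ →* K) (hρ : Function.Injective ρ)
    (hrange : ρ.range ≤ (lift f).range)
    (hconj : ∀ (i) (x : G i), ∀ g ∈ (lift f).range, ∀ γ, ρ γ = g⁻¹ * f i x * g → f i x = 1) :
    IsFreeGroup Γ := by
  have : IsFreeGroup (ρ.range.comap (lift f)) := isFreeGroup_of_conj_notMem _ (by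
    rintro i x g ⟨γ, hγ⟩
    have := hconj i x (lift f g) ⟨g, rfl⟩ γ (by simpa using hγ)
    refine of_injective i (hf ?_)
    simpa using this)
  have e : ρ.range.comap (lift f) ≃* ρ.range :=
    ((ρ.range.comap (lift f)).equivMapOfInjective _ hf).trans
      (MulEquiv.subgroupCongr (Subgroup.map_comap_eq_self hrange))
  exact IsFreeGroup.ofMulEquiv (e.trans (MonoidHom.ofInjective hρ).symm)

end Monoid.CoprodI

namespace Subgroup

theorem eq_one_or_eq_of_mem_zpowers {G : Type*} [Group G] {g x : G} (hg : g ^ 2 = 1)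
    (hx : x ∈ zpowers g) : x = 1 ∨ x = g := by
  obtain ⟨n, rfl⟩ := hx
  dsimp only
  have h2 (k : ℤ) : g ^ (2 * k) = 1 := by rw [zpow_mul, zpow_ofNat, hg, one_zpow]
  rcases Int.even_or_odd' n with ⟨k, rfl | rfl⟩
  · exact .inl (h2 k)
  · exact .inr (by rw [zpow_add, h2, one_mul, zpow_one])

theorem eq_one_or_eq_or_eq_inv_of_mem_zpowers {G : Type*} [Group G] {g x : G} (hg : g ^ 3 = 1)
    (hx : x ∈ zpowers g) : x = 1 ∨ x = g ∨ x = g⁻¹ := by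
  obtain ⟨n, rfl⟩ := hx
  dsimp only
  have h3 (k : ℤ) : g ^ (3 * k) = 1 := by rw [zpow_mul, zpow_ofNat, hg, one_zpow]
  obtain h | h | h : n = 3 * (n / 3) ∨ n = 3 * (n / 3) + 1 ∨ n = 3 * (n / 3 + 1) + -1 := by omega
  · exact .inl (by rw [h, h3])
  · exact .inr (.inl (by rw [h, zpow_add, h3, one_mul, zpow_one]))
  · exact .inr (.inr (by rw [h, zpow_add, h3, one_mul, zpow_neg_one]))

end Subgroup

namespace ModularGroup

open Matrix MatrixGroups Pointwise

theorem conj_eq_conj_iff {g h : SL(2, ℤ)} : MulAut.conj g = MulAut.conj h ↔ g = h ∨ g = -h := by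
  constructor
  · intro hgh
    have hc : h⁻¹ * g ∈ Subgroup.center SL(2, ℤ) := by
      rw [Subgroup.mem_center_iff]
      intro x
      have := DFunLike.congr_fun hgh x
      simp only [MulAut.conj_apply] at this
      rw [mul_inv_eq_iff_eq_mul] at this
      rw [mul_assoc, this]
      group
    obtain ⟨r, hr, hrg⟩ := Matrix.SpecialLinearGroup.mem_center_iff.mp hc
    rcases (show r = 1 ∨ r = -1 by simpa using hr) with rfl | rfl
    · have : h⁻¹ * g = 1 := Subtype.ext (hrg.symm.trans (by simp))
      exact .inl (inv_mul_eq_one.mp this).symm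
    · have : h⁻¹ * g = -1 := Subtype.ext (hrg.symm.trans (by simp))
      exact .inr (by rw [← mul_neg_one, ← this, mul_inv_cancel_left])
  · rintro (rfl | rfl)
    · rfl
    · ext1 x
      simp

theorem trace_inv_mul_mul (g h : SL(2, ℤ)) :
    trace (h⁻¹ * g * h : SL(2, ℤ)).1 = trace g.1 := by
  have : h * (h⁻¹ * g) = g := mul_inv_cancel_left h g
  rw [Matrix.SpecialLinearGroup.coe_mul, trace_mul_comm, ← Matrix.SpecialLinearGroup.coe_mul, this]

theorem coe_S_inv : ((S⁻¹ : SL(2, ℤ)) : Matrix (Fin 2) (Fin 2) ℤ) = !![0, 1; -1, 0] := by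
  decide

theorem coe_T_mul_S : ((T * S : SL(2, ℤ)) : Matrix (Fin 2) (Fin 2) ℤ) = !![1, -1; 1, 0] := by
  decide

theorem coe_T_mul_S_inv :
    (((T * S)⁻¹ : SL(2, ℤ)) : Matrix (Fin 2) (Fin 2) ℤ) = !![0, 1; -1, 1] := by
  decide

theorem conj_S_sq : MulAut.conj S ^ 2 = 1 := by
  rw [← map_pow, ← map_one MulAut.conj, conj_eq_conj_iff]
  exact .inr (by decide)

theorem conj_T_mul_S_cube : MulAut.conj (T * S) ^ 3 = 1 := by
  rw [← map_pow, ← map_one MulAut.conj, conj_eq_conj_iff]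
  exact .inr (by decide)

theorem conj_T_mul_S_ne_one : MulAut.conj (T * S) ≠ 1 := by
  rw [← map_one MulAut.conj, Ne, conj_eq_conj_iff]
  decide

/-- Inner automorphisms of `SL(2, ℤ)` generating the two finite free factors of `PSL(2, ℤ)`. -/
def factorGenerator (b : Bool) : MulAut SL(2, ℤ) :=
  MulAut.conj (if b then T * S else S)

/-- The inclusions of the two finite free factors of `PSL(2, ℤ)` in the automorphism group of
`SL(2, ℤ)`. -/
def factorInclusion (b : Bool) : Subgroup.zpowers (factorGenerator b) →* MulAut SL(2, ℤ) :=
  (Subgroup.zpowers (factorGenerator b)).subtype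

/-- The sets on which the two factors of `PSL(2, ℤ)` play ping-pong by conjugation. -/
def pingPongSet (b : Bool) : Set SL(2, ℤ) :=
  {M | 0 < M 0 1 ∧ M 1 0 < 0 ∧ if b then M 0 0 < M 1 1 else M 1 1 < M 0 0}

theorem pingPongSet_nonempty (b : Bool) : (pingPongSet b).Nonempty := by
  cases b
  · refine ⟨⟨!![1, 1; -1, 0], by simp⟩, ?_⟩
    change (0 : ℤ) < 1 ∧ (-1 : ℤ) < 0 ∧ (0 : ℤ) < 1
    decide
  · refine ⟨⟨!![0, 1; -1, 1], by simp⟩, ?_⟩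
    change (0 : ℤ) < 1 ∧ (-1 : ℤ) < 0 ∧ (0 : ℤ) < 1
    decide

theorem pairwise_disjoint_pingPongSet : Pairwise (Function.onFun Disjoint pingPongSet) := by
  rintro (_ | _) (_ | _) h <;> simp at h <;> rw [Function.onFun, Set.disjoint_left] <;>
    simp +contextual [pingPongSet, le_of_lt]

theorem conj_S_smul_pingPongSet : MulAut.conj S • pingPongSet true ⊆ pingPongSet false := by
  rintro _ ⟨M, ⟨h₁, h₂, h₃⟩, rfl⟩
  change S * M * S⁻¹ ∈ pingPongSet false
  simp only [pingPongSet, Set.mem_ofPred_eq, Matrix.SpecialLinearGroup.coe_mul,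
    coe_S, coe_S_inv] at h₃ ⊢
  simp [mul_apply, Fin.sum_univ_two, vecMul, dotProduct] at h₃ ⊢
  omega

theorem conj_T_mul_S_smul_pingPongSet :
    MulAut.conj (T * S) • pingPongSet false ⊆ pingPongSet true := by
  rintro _ ⟨M, ⟨h₁, h₂, h₃⟩, rfl⟩
  change (T * S) * M * (T * S)⁻¹ ∈ pingPongSet true
  simp only [pingPongSet, Set.mem_ofPred_eq, Matrix.SpecialLinearGroup.coe_mul _ (T * S)⁻¹,
    Matrix.SpecialLinearGroup.coe_mul _ M, coe_T_mul_S, coe_T_mul_S_inv] at h₃ ⊢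
  simp [mul_apply, Fin.sum_univ_two, vecMul, dotProduct] at h₃ ⊢
  omega

theorem conj_T_mul_S_inv_smul_pingPongSet :
    (MulAut.conj (T * S))⁻¹ • pingPongSet false ⊆ pingPongSet true := by
  rintro _ ⟨M, ⟨h₁, h₂, h₃⟩, rfl⟩
  change (T * S)⁻¹ * M * (T * S) ∈ pingPongSet true
  simp only [pingPongSet, Set.mem_ofPred_eq, Matrix.SpecialLinearGroup.coe_mul _ (T * S),
    Matrix.SpecialLinearGroup.coe_mul _ M, coe_T_mul_S, coe_T_mul_S_inv] at h₃ ⊢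
  simp [mul_apply, Fin.sum_univ_two, vecMul, dotProduct] at h₃ ⊢
  omega

/-- The inner automorphism group of `SL(2, ℤ)`, which is `PSL(2, ℤ)`, contains the free product of
the cyclic groups generated by `S` and `T * S`. -/
theorem lift_factorInclusion_injective :
    Function.Injective (Monoid.CoprodI.lift factorInclusion) := by
  refine Monoid.CoprodI.lift_injective_of_ping_pong factorInclusion (.inr ⟨true, ?_⟩) pingPongSet
    pingPongSet_nonempty pairwise_disjoint_pingPongSet ?_
  · have hcard : Nat.card (Subgroup.zpowers (factorGenerator true)) = 3 := by
      rw [Nat.card_zpowers]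
      exact orderOf_eq_prime conj_T_mul_S_cube conj_T_mul_S_ne_one
    have := Nat.finite_of_card_ne_zero (hcard.trans_ne three_ne_zero)
    rw [← Nat.cast_card, hcard]
    norm_num
  · rintro (_ | _) (_ | _) hij ⟨x, hx⟩ hx1 <;> simp only [ne_eq, not_true_eq_false] at hij
    · obtain rfl | rfl := Subgroup.eq_one_or_eq_of_mem_zpowers conj_S_sq hx
      · exact absurd rfl hx1
      · exact conj_S_smul_pingPongSet
    · obtain rfl | rfl | rfl :=
        Subgroup.eq_one_or_eq_or_eq_inv_of_mem_zpowers conj_T_mul_S_cube hx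
      · exact absurd rfl hx1
      · exact conj_T_mul_S_smul_pingPongSet
      · exact conj_T_mul_S_inv_smul_pingPongSet

theorem range_lift_factorInclusion :
    (Monoid.CoprodI.lift factorInclusion).range = (MulAut.conj (G := SL(2, ℤ))).range := by
  have hmem (b : Bool) : factorGenerator b ∈ (Monoid.CoprodI.lift factorInclusion).range :=
    ⟨Monoid.CoprodI.of (i := b) ⟨_, Subgroup.mem_zpowers _⟩, by simp [factorInclusion]⟩
  apply le_antisymm
  · rw [Monoid.CoprodI.range_eq_iSup, iSup_le_iff]
    intro b
    rw [factorInclusion, Subgroup.range_subtype, Subgroup.zpowers_le]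
    exact ⟨_, rfl⟩
  · rw [MonoidHom.range_eq_map, ← SpecialLinearGroup.SL2Z_generators, Subgroup.map_le_iff_le_comap,
      Subgroup.closure_le]
    rintro _ (rfl | rfl)
    · exact hmem false
    · simpa [factorGenerator] using mul_mem (hmem true) (inv_mem (hmem false))

theorem abs_trace_le_one_of_mem_zpowers {b : Bool} {x : MulAut SL(2, ℤ)}
    (hx : x ∈ Subgroup.zpowers (factorGenerator b)) (hx1 : x ≠ 1) :
    ∃ M : SL(2, ℤ), MulAut.conj M = x ∧ |trace M.1| ≤ 1 := by
  cases b
  · obtain rfl | rfl := Subgroup.eq_one_or_eq_of_mem_zpowers conj_S_sq hx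
    · exact absurd rfl hx1
    · exact ⟨S, rfl, by decide⟩
  · obtain rfl | rfl | rfl :=
      Subgroup.eq_one_or_eq_or_eq_inv_of_mem_zpowers conj_T_mul_S_cube hx
    · exact absurd rfl hx1
    · exact ⟨T * S, rfl, by decide⟩
    · exact ⟨(T * S)⁻¹, map_inv _ _, by decide⟩

/-- A subgroup of `SL(2, ℤ)` with neither `-1` nor elements of trace `0`, `1` or `-1` is free. -/
theorem isFreeGroup_of_one_lt_abs_trace (Γ : Subgroup SL(2, ℤ)) (hneg : -1 ∉ Γ)
    (htrace : ∀ γ ∈ Γ, 1 < |trace γ.1|) : IsFreeGroup Γ := by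
  refine Monoid.CoprodI.isFreeGroup_of_lift_injective factorInclusion
    lift_factorInclusion_injective (MulAut.conj.comp Γ.subtype) ?_ ?_ ?_
  · rw [injective_iff_map_eq_one]
    rintro ⟨γ, hγ⟩ h
    obtain rfl | rfl := conj_eq_conj_iff.mp (show MulAut.conj γ = MulAut.conj 1 by simpa using h)
    · rfl
    · exact absurd hγ hneg
  · rw [range_lift_factorInclusion]
    rintro _ ⟨γ, rfl⟩
    exact ⟨γ, rfl⟩
  · rintro b ⟨x, hx⟩ g hg ⟨γ, hγ⟩ h
    rw [range_lift_factorInclusion] at hg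
    obtain ⟨g, rfl⟩ := hg
    by_contra hx1
    obtain ⟨M, rfl, hM⟩ := abs_trace_le_one_of_mem_zpowers hx hx1
    have hconj : MulAut.conj γ = MulAut.conj (g⁻¹ * M * g) := by
      rw [map_mul, map_mul, map_inv]
      exact h
    refine (htrace γ hγ).not_ge ?_
    obtain rfl | rfl := conj_eq_conj_iff.mp hconj
    · rwa [trace_inv_mul_mul]
    · rwa [Matrix.SpecialLinearGroup.coe_neg, trace_neg, abs_neg, trace_inv_mul_mul]

end ModularGroup

namespace CongruenceSubgroup

open Matrix MatrixGroups

theorem one_lt_abs_trace_of_mem_Gamma1 {m : ℕ} (hm : 4 ≤ m) {γ : SL(2, ℤ)} (hγ : γ ∈ Gamma1 m) :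
    1 < |trace γ.1| := by
  rw [Gamma1_mem] at hγ
  have h : (m : ℤ) ∣ trace γ.1 - 2 := by
    rw [← ZMod.intCast_zmod_eq_zero_iff_dvd]
    simp [trace_fin_two, hγ.1, hγ.2.1]
    ring
  by_contra! hlt
  rw [abs_le] at hlt
  have := Int.le_of_dvd (by omega) (dvd_sub_comm.mp h)
  omega

theorem neg_one_notMem_Gamma1 {m : ℕ} (hm : 3 ≤ m) : -1 ∉ Gamma1 m := by
  rw [Gamma1_mem]
  rintro ⟨h, -⟩
  have h2 : (m : ℤ) ∣ 2 := by
    rw [← ZMod.intCast_zmod_eq_zero_iff_dvd]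
    replace h : (-1 : ZMod m) = 1 := by simpa using h
    calc ((2 : ℤ) : ZMod m) = 1 - (-1) := by norm_num
      _ = 0 := by rw [h, sub_self]
  have := Int.le_of_dvd two_pos h2
  omega

end CongruenceSubgroup

/-- For `m ≥ 4`, the congruence subgroup `Γ₁(m)` of `SL₂(ℤ)` (matrices with
`a ≡ 1`, `d ≡ 1`, `c ≡ 0 (mod m)`) is a free group. -/
theorem Gamma1_free (m : ℕ) (hm : 4 ≤ m) :
    IsFreeGroup (CongruenceSubgroup.Gamma1 m) :=
  ModularGroup.isFreeGroup_of_one_lt_abs_trace _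
    (CongruenceSubgroup.neg_one_notMem_Gamma1 (by omega))
    fun _ hγ => CongruenceSubgroup.one_lt_abs_trace_of_mem_Gamma1 hm hγ
end

section
/- Let m and r be positive integers. If there exists g ∈ SL₂(ℤ) such that g·Γ₁(r)·g⁻¹ is contained in Γ₁(m), then m divides r. -/
/-- An element conjugated by `g` into `Γ₁(m)` fixes the bottom row of `g` modulo `m`. -/
theorem CongruenceSubgroup.dvd_bottom_row_mul_sub_of_conj_mem_Gamma1 {m : ℕ}
    {g x : Matrix.SpecialLinearGroup (Fin 2) ℤ}
    (h : g * x * g⁻¹ ∈ CongruenceSubgroup.Gamma1 m) (j : Fin 2) :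
    (m : ℤ) ∣ g 1 0 * x 0 j + g 1 1 * x 1 j - g 1 j := by
  obtain ⟨y, hy⟩ : ∃ y, y = g * x * g⁻¹ := ⟨_, rfl⟩
  rw [← hy, CongruenceSubgroup.Gamma1_mem] at h
  obtain ⟨-, h11, h10⟩ := h
  have hyg : g * x = y * g := by rw [hy]; group
  have hmul : (g * x) 1 j = g 1 0 * x 0 j + g 1 1 * x 1 j := by
    simp [Matrix.mul_apply, Fin.sum_univ_two]
  rw [← ZMod.intCast_zmod_eq_zero_iff_dvd, ← hmul, hyg]
  simp [Matrix.mul_apply, Fin.sum_univ_two, h11, h10]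

/-- If some conjugate `g·Γ₁(r)·g⁻¹` (with `g ∈ SL₂(ℤ)`) is contained in
`Γ₁(m)`, then `m` divides `r`. -/
theorem dvd_of_conjugate_Gamma1_le (m r : ℕ) (hm : 0 < m) (hr : 0 < r)
    (h : ∃ g : Matrix.SpecialLinearGroup (Fin 2) ℤ,
      ∀ x ∈ CongruenceSubgroup.Gamma1 r,
        g * x * g⁻¹ ∈ CongruenceSubgroup.Gamma1 m) :
    m ∣ r := by
  obtain ⟨g, hg⟩ := h
  have upper : (m : ℤ) ∣ g 1 0 := by
    let x : Matrix.SpecialLinearGroup (Fin 2) ℤ := ⟨!![1, 1; 0, 1], by simp⟩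
    have hx : x ∈ CongruenceSubgroup.Gamma1 r :=
      (CongruenceSubgroup.Gamma1_mem r x).2 (by simp [x])
    simpa [x] using
      CongruenceSubgroup.dvd_bottom_row_mul_sub_of_conj_mem_Gamma1 (hg x hx) 1
  have lower : (m : ℤ) ∣ g 1 1 * r := by
    let x : Matrix.SpecialLinearGroup (Fin 2) ℤ := ⟨!![1, 0; (r : ℤ), 1], by simp⟩
    have hx : x ∈ CongruenceSubgroup.Gamma1 r :=
      (CongruenceSubgroup.Gamma1_mem r x).2 (by simp [x])
    simpa [x] using
      CongruenceSubgroup.dvd_bottom_row_mul_sub_of_conj_mem_Gamma1 (hg x hx) 0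
  have hdet := g.det_coe
  rw [Matrix.det_fin_two] at hdet
  have hr_eq : (r : ℤ) = g 0 0 * (g 1 1 * r) - g 1 0 * (g 0 1 * r) := by
    linear_combination -(r : ℤ) * hdet
  rw [← Int.natCast_dvd_natCast, hr_eq]
  exact dvd_sub (dvd_mul_of_dvd_right lower _) (dvd_mul_of_dvd_left upper _)
end

section
/- Let m and r be positive integers with m dividing r. Then J₂(r) ≠ 2·J₂(m). -/
/-- Jordan's 2-totient: the number of elements of `(ℤ/nℤ)²` of additive order
exactly `n`. -/
noncomputable def J2 (n : ℕ) : ℕ := Nat.card {x : ZMod n × ZMod n // addOrderOf x = n}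

/-- The pairs of residues `0 ≤ a, b < n` with `gcd (a, b, n) = 1`. -/
def primitivePairs (n : ℕ) : Finset (ℕ × ℕ) :=
  (Finset.range n ×ˢ Finset.range n).filter fun x => ((x.1.gcd x.2).Coprime n)

lemma mem_primitivePairs {n : ℕ} {x : ℕ × ℕ} :
    x ∈ primitivePairs n ↔ (x.1 < n ∧ x.2 < n) ∧ (x.1.gcd x.2).Coprime n := by
  simp [primitivePairs]

lemma addOrderOf_natCast_prod_eq_iff {n : ℕ} (hn : 0 < n) (a b : ℕ) :
    addOrderOf ((a : ZMod n), (b : ZMod n)) = n ↔ (a.gcd b).Coprime n := by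
  have nsmul_eq_zero (d : ℕ) : d • ((a : ZMod n), (b : ZMod n)) = 0 ↔ n ∣ d * a.gcd b := by
    rw [← Nat.gcd_mul_left, Nat.dvd_gcd_iff, ← ZMod.natCast_eq_zero_iff, ← ZMod.natCast_eq_zero_iff]
    simp [Prod.ext_iff]
  constructor
  · intro h
    set g := (a.gcd b).gcd n
    obtain ⟨c, hc⟩ : g ∣ n := Nat.gcd_dvd_right _ _
    have hdvd : n ∣ c * a.gcd b := by
      conv_lhs => rw [hc, mul_comm]
      exact mul_dvd_mul_left c (Nat.gcd_dvd_left _ _)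
    have hnc : n ∣ c := by
      have := addOrderOf_dvd_of_nsmul_eq_zero ((nsmul_eq_zero c).2 hdvd)
      rwa [h] at this
    have hc0 : 0 < c := Nat.pos_of_ne_zero (by rintro rfl; omega)
    have hle := Nat.le_of_dvd hc0 hnc
    have hg : g ≠ 0 := by intro h0; rw [h0] at hc; omega
    change g = 1
    by_contra hne
    have : 2 ≤ g := by omega
    nlinarith
  · intro h
    refine Nat.dvd_antisymm ?_ ?_
    · exact addOrderOf_dvd_of_nsmul_eq_zero ((nsmul_eq_zero n).2 (dvd_mul_right _ _))
    · exact h.symm.dvd_of_dvd_mul_right ((nsmul_eq_zero _).1 (addOrderOf_nsmul_eq_zero _))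

lemma J2_eq_card_primitivePairs {n : ℕ} (hn : 0 < n) : J2 n = (primitivePairs n).card := by
  have : NeZero n := ⟨hn.ne'⟩
  rw [J2, ← Nat.card_eq_finsetCard]
  refine Nat.card_congr
    { toFun := fun x => ⟨(x.1.1.val, x.1.2.val), ?_⟩
      invFun := fun y => ⟨((y.1.1 : ZMod n), (y.1.2 : ZMod n)), ?_⟩
      left_inv := ?_
      right_inv := ?_ }
  · refine mem_primitivePairs.2 ⟨⟨ZMod.val_lt _, ZMod.val_lt _⟩, ?_⟩
    rw [← addOrderOf_natCast_prod_eq_iff hn]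
    simpa using x.2
  · exact (addOrderOf_natCast_prod_eq_iff hn _ _).2 (mem_primitivePairs.1 y.2).2
  · intro x
    simp
  · intro y
    obtain ⟨⟨h₁, h₂⟩, -⟩ := mem_primitivePairs.1 y.2
    ext <;> simp [ZMod.val_natCast, Nat.mod_eq_of_lt, h₁, h₂]

lemma J2_pos {n : ℕ} (hn : 0 < n) : 0 < J2 n := by
  rw [J2_eq_card_primitivePairs hn, Finset.card_pos]
  rcases (Nat.succ_le_of_lt hn).eq_or_lt with rfl | h
  · exact ⟨(0, 0), by simp [mem_primitivePairs]⟩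
  · exact ⟨(1, 0), by simp [mem_primitivePairs]; omega⟩

lemma dvd_of_not_coprime_lift {m p a b i j : ℕ} (hp : p.Prime) (hab : (a.gcd b).Coprime m)
    (h : ¬((a + m * i).gcd (b + m * j)).Coprime (m * p)) :
    ¬p ∣ m ∧ p ∣ a + m * i ∧ p ∣ b + m * j := by
  obtain ⟨q, hq, hqg, hqmp⟩ := Nat.Prime.not_coprime_iff_dvd.1 h
  obtain ⟨hqa, hqb⟩ := Nat.dvd_gcd_iff.1 hqg
  have hqm : ¬q ∣ m := fun hqm =>
    Nat.Prime.not_coprime_iff_dvd.2 ⟨q, hq, Nat.dvd_gcd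
      ((Nat.dvd_add_left (hqm.mul_right i)).1 hqa)
      ((Nat.dvd_add_left (hqm.mul_right j)).1 hqb), hqm⟩ hab
  obtain rfl := (Nat.prime_dvd_prime_iff_eq hq hp).1 ((hq.dvd_mul.1 hqmp).resolve_left hqm)
  exact ⟨hqm, hqa, hqb⟩

lemma eq_of_prime_dvd_add_mul {m p a i j : ℕ} (hp : p.Prime) (hpm : ¬p ∣ m) (hi : i < p)
    (hj : j < p) (h₁ : p ∣ a + m * i) (h₂ : p ∣ a + m * j) : i = j := by
  have h : a + m * i ≡ a + m * j [MOD p] :=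
    ((Nat.modEq_zero_iff_dvd).2 h₁).trans ((Nat.modEq_zero_iff_dvd).2 h₂).symm
  exact (((Nat.ModEq.add_left_cancel' a h).cancel_left_of_coprime
    ((Nat.Prime.coprime_iff_not_dvd hp).2 hpm))).eq_of_lt_of_lt hi hj

lemma eq_and_eq_of_add_mul_eq {m a b i j : ℕ} (ha : a < m) (hb : b < m)
    (h : a + m * i = b + m * j) : a = b ∧ i = j := by
  have hab : a = b := by
    simpa [Nat.mod_eq_of_lt, ha, hb] using congrArg (· % m) h
  subst hab
  exact ⟨rfl, Nat.eq_of_mul_eq_mul_left (by omega) (Nat.add_left_cancel h)⟩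

lemma three_mul_J2_le_J2_mul_prime {m p : ℕ} (hm : 0 < m) (hp : p.Prime) :
    3 * J2 m ≤ J2 (m * p) := by
  rw [J2_eq_card_primitivePairs hm, J2_eq_card_primitivePairs (Nat.mul_pos hm hp.pos)]
  let lifts := primitivePairs m ×ˢ (Finset.range 2 ×ˢ Finset.range 2)
  let lift (x : (ℕ × ℕ) × (ℕ × ℕ)) : ℕ × ℕ := (x.1.1 + m * x.2.1, x.1.2 + m * x.2.2)
  let good (x : (ℕ × ℕ) × (ℕ × ℕ)) : Prop := ((lift x).1.gcd (lift x).2).Coprime (m * p)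
  have hp2 := hp.two_le
  have hmem {x} (hx : x ∈ lifts) : ((x.1.1 < m ∧ x.1.2 < m) ∧ (x.1.1.gcd x.1.2).Coprime m) ∧
      x.2.1 < 2 ∧ x.2.2 < 2 := by
    simpa [lifts, mem_primitivePairs] using hx
  have hgood : (lifts.filter good).card ≤ (primitivePairs (m * p)).card := by
    refine Finset.card_le_card_of_injOn lift ?_ ?_
    · intro x hx
      obtain ⟨hx, hxg⟩ := Finset.mem_filter.1 hx
      obtain ⟨⟨⟨h₁, h₂⟩, -⟩, h₃, h₄⟩ := hmem hx
      refine mem_primitivePairs.2 ⟨⟨?_, ?_⟩, hxg⟩ <;> dsimp only [lift] <;> nlinarith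
    · rintro ⟨⟨a, b⟩, i, j⟩ hx ⟨⟨a', b'⟩, i', j'⟩ hy h
      obtain ⟨⟨⟨h₁, h₂⟩, -⟩, -⟩ := hmem (Finset.mem_filter.1 hx).1
      obtain ⟨⟨⟨h₁', h₂'⟩, -⟩, -⟩ := hmem (Finset.mem_filter.1 hy).1
      obtain ⟨rfl, rfl⟩ := eq_and_eq_of_add_mul_eq h₁ h₁' (congrArg Prod.fst h)
      obtain ⟨rfl, rfl⟩ := eq_and_eq_of_add_mul_eq h₂ h₂' (congrArg Prod.snd h)
      rfl
  have hbad : (lifts.filter (¬good ·)).card ≤ (primitivePairs m).card := by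
    refine Finset.card_le_card_of_injOn Prod.fst ?_ ?_
    · intro x hx
      exact (Finset.mem_product.1 (Finset.mem_filter.1 hx).1).1
    · rintro ⟨⟨a, b⟩, i, j⟩ hx ⟨⟨a', b'⟩, i', j'⟩ hy h
      obtain ⟨rfl, rfl⟩ := Prod.mk.inj h
      obtain ⟨hx, hxg⟩ := Finset.mem_filter.1 hx
      obtain ⟨hy, hyg⟩ := Finset.mem_filter.1 hy
      obtain ⟨⟨-, hab⟩, hi, hj⟩ := hmem hx
      obtain ⟨-, hi', hj'⟩ := hmem hy
      obtain ⟨hpm, ha, hb⟩ := dvd_of_not_coprime_lift hp hab hxg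
      obtain ⟨-, ha', hb'⟩ := dvd_of_not_coprime_lift hp hab hyg
      obtain rfl := eq_of_prime_dvd_add_mul hp hpm (hi.trans_le hp2) (hi'.trans_le hp2) ha ha'
      obtain rfl := eq_of_prime_dvd_add_mul hp hpm (hj.trans_le hp2) (hj'.trans_le hp2) hb hb'
      rfl
  have hcard : lifts.card = (primitivePairs m).card * 4 := by
    simp [lifts]
  have hsplit := Finset.card_filter_add_card_filter_not (s := lifts) good
  omega

lemma J2_le_J2_mul {m k : ℕ} (hm : 0 < m) (hk : 0 < k) : J2 m ≤ J2 (m * k) := by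
  induction k using Nat.recOnMul generalizing m with
  | zero => omega
  | one => simp
  | prime p hp => linarith [three_mul_J2_le_J2_mul_prime hm hp]
  | mul a b iha ihb =>
    have ha := Nat.pos_of_mul_pos_right hk
    have hb := Nat.pos_of_mul_pos_left hk
    rw [← mul_assoc]
    exact (iha hm ha).trans (ihb (Nat.mul_pos hm ha) hb)

/-- If `m` and `r` are positive integers with `m ∣ r`, then `J₂(r) ≠ 2·J₂(m)`. -/
theorem J2_ne_two_mul (m r : ℕ) (hm : 0 < m) (hr : 0 < r) (hdvd : m ∣ r) :
    J2 r ≠ 2 * J2 m := by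
  have hpos := J2_pos hm
  obtain ⟨k, rfl⟩ := hdvd
  by_cases hk : k = 1
  · subst hk
    rw [mul_one]
    omega
  · obtain ⟨p, hp, l, rfl⟩ := Nat.exists_prime_and_dvd hk
    have h₁ := three_mul_J2_le_J2_mul_prime hm hp
    rw [← mul_assoc] at hr ⊢
    have h₂ := J2_le_J2_mul (Nat.mul_pos hm hp.pos) (Nat.pos_of_mul_pos_left hr)
    omega
end

section
/- For every positive integer m, the number of elements x of the group (ℤ/3mℤ)² such that (3k)·x ≠ 0 for every integer k with 1 ≤ k < m equals 9·J₂(m). (Every element of (ℤ/3mℤ)² is 3m-torsion, so this counts the elements that are 3m-torsion but not 3k-torsion for any k < m, i.e. the number of points of type 3m on a smooth cubic plane curve.) -/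
theorem AddMonoidHom.card_subtype_comp_of_surjective {G H : Type*} [AddGroup G] [AddGroup H]
    {f : G →+ H} (hf : Function.Surjective f) (p : H → Prop) :
    Nat.card {x : G // p (f x)} = Nat.card f.ker * Nat.card {y : H // p y} := by
  have e : {x : G // p (f x)} ≃ f.ker × {y : H // p y} :=
    ((Equiv.sigmaSubtypeFiberEquivSubtype f (p := fun x => p (f x)) (q := p)
      fun _ => Iff.rfl).symm.trans
      (Equiv.sigmaCongrRight fun y => f.fiberEquivKerOfSurjective hf y.1)).trans
      ((Equiv.sigmaEquivProd _ _).trans (Equiv.prodComm _ _))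
  rw [Nat.card_congr e, Nat.card_prod]

theorem ZMod.mul_nsmul_eq_zero_iff {d n : ℕ} (hd : d ≠ 0) (k : ℕ) (x : ZMod (d * n)) :
    (d * k) • x = 0 ↔ k • ZMod.castHom (dvd_mul_left n d) (ZMod n) x = 0 := by
  obtain ⟨a, rfl⟩ := ZMod.intCast_surjective x
  rw [map_intCast, ← natCast_zsmul, ← natCast_zsmul, zsmul_eq_mul, zsmul_eq_mul,
    ← Int.cast_mul, ← Int.cast_mul, ZMod.intCast_zmod_eq_zero_iff_dvd,
    ZMod.intCast_zmod_eq_zero_iff_dvd]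
  push_cast
  rw [mul_assoc, mul_dvd_mul_iff_left (by exact_mod_cast hd)]

theorem ZMod.addOrderOf_prod_eq_iff {n : ℕ} (hn : 0 < n) (y : ZMod n × ZMod n) :
    addOrderOf y = n ↔ ∀ k : ℕ, 1 ≤ k → k < n → k • y ≠ 0 := by
  have h : n • y = 0 := by ext <;> simp
  rw [addOrderOf_eq_iff hn]
  exact ⟨fun H k hk hkn => H.2 k hkn hk, fun H => ⟨h, fun k hkn hk => H k hk hkn⟩⟩

/-- For every positive integer `m`, the number of elements `x` of `(ℤ/3mℤ)²`
with `(3k)·x ≠ 0` for every `1 ≤ k < m` (i.e. the elements that are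
`3m`-torsion but not `3k`-torsion for any `k < m`: the points of type `3m` on
a smooth cubic plane curve) equals `9·J₂(m)`. -/
theorem card_type_3m_points (m : ℕ) (hm : 0 < m) :
    Nat.card {x : ZMod (3 * m) × ZMod (3 * m) //
        ∀ k : ℕ, 1 ≤ k → k < m → (3 * k) • x ≠ 0} = 9 * J2 m := by
  let π : ZMod (3 * m) →+ ZMod m := (ZMod.castHom (dvd_mul_left m 3) (ZMod m)).toAddMonoidHom
  let f : ZMod (3 * m) × ZMod (3 * m) →+ ZMod m × ZMod m := π.prodMap π
  have hπ : Function.Surjective π := ZMod.castHom_surjective (dvd_mul_left m 3)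
  have hf : Function.Surjective f := hπ.prodMap hπ
  have hker : Nat.card f.ker = 9 := by
    have h := AddMonoidHom.card_subtype_comp_of_surjective hf fun _ => True
    simp only [Nat.card_congr (Equiv.subtypeUnivEquiv fun _ => trivial), Nat.card_prod,
      Nat.card_zmod] at h
    exact Nat.eq_of_mul_eq_mul_right (Nat.mul_pos hm hm) (by linarith)
  have hnsmul (k : ℕ) (x : ZMod (3 * m) × ZMod (3 * m)) : (3 * k) • x = 0 ↔ k • f x = 0 := by
    rw [Prod.ext_iff, Prod.ext_iff]
    exact and_congr (ZMod.mul_nsmul_eq_zero_iff three_ne_zero k x.1)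
      (ZMod.mul_nsmul_eq_zero_iff three_ne_zero k x.2)
  rw [J2, ← hker, ← AddMonoidHom.card_subtype_comp_of_surjective hf]
  simp only [ne_eq, hnsmul, ZMod.addOrderOf_prod_eq_iff hm]
end

section
/- Let v ∈ ℝ². If the image in the torus ℝ²/ℤ² of the orbit {A·v : A ∈ SL₂(ℤ)} (where A acts by matrix–vector multiplication) is a finite set, then both coordinates of v are rational, i.e. v ∈ ℚ². -/
open Matrix

/-- A real number `x` is rational if the points `y + n x`, `n ∈ ℤ`, have finitely many images
in `ℝ/ℤ`. -/
theorem exists_rat_eq_of_finite_range_add_zsmul (x y : ℝ)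
    (h : (Set.range fun n : ℤ => ((y + n * x : ℝ) : AddCircle (1 : ℝ))).Finite) :
    ∃ q : ℚ, x = (q : ℝ) := by
  have : Finite (Set.range fun n : ℤ => ((y + n * x : ℝ) : AddCircle (1 : ℝ))) := h
  obtain ⟨m, n, hmn, heq⟩ := Finite.exists_ne_map_eq_of_infinite
    (Set.rangeFactorization fun n : ℤ => ((y + n * x : ℝ) : AddCircle (1 : ℝ)))
  have heq' : ((y + m * x : ℝ) : AddCircle (1 : ℝ)) = ((y + n * x : ℝ) : AddCircle (1 : ℝ)) :=
    congrArg Subtype.val heq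
  obtain ⟨k, hk⟩ := AddSubgroup.mem_zmultiples_iff.1 (QuotientAddGroup.eq_iff_sub_mem.1 heq')
  have hne : (m : ℝ) - n ≠ 0 := sub_ne_zero.2 (by exact_mod_cast hmn)
  refine ⟨k / (m - n), ?_⟩
  push_cast
  rw [eq_div_iff hne]
  rw [zsmul_one] at hk
  linarith

/-- Let `v ∈ ℝ²`.  If the image in the torus `ℝ²/ℤ² ≅ (ℝ/ℤ)²` of the orbit
`{A·v : A ∈ SL₂(ℤ)}` (matrix–vector multiplication) is finite, then both
coordinates of `v` are rational. -/
theorem rational_of_finite_torus_orbit (v : Fin 2 → ℝ)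
    (hfin : (Set.range (fun A : SL2Z => fun i : Fin 2 =>
        ((((A : Matrix (Fin 2) (Fin 2) ℤ).map (Int.cast : ℤ → ℝ)) *ᵥ v) i :
          AddCircle (1 : ℝ)))).Finite) :
    ∀ i : Fin 2, ∃ q : ℚ, v i = (q : ℝ) := by
  have key (i j : Fin 2) (A : ℤ → SL2Z) (hA : ∀ n,
      (((A n : Matrix (Fin 2) (Fin 2) ℤ).map (Int.cast : ℤ → ℝ)) *ᵥ v) j = v j + n * v i) :
      ∃ q : ℚ, v i = (q : ℝ) := by
    refine exists_rat_eq_of_finite_range_add_zsmul (v i) (v j)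
      ((hfin.image fun w => w j).subset ?_)
    rintro _ ⟨n, rfl⟩
    exact ⟨_, ⟨A n, rfl⟩, congrArg _ (hA n)⟩
  rw [Fin.forall_fin_two]
  constructor
  · refine key 0 1 (fun n => ⟨!![1, 0; n, 1], by simp⟩) fun n => ?_
    simp [Matrix.mulVec, dotProduct, Fin.sum_univ_two, add_comm]
  · refine key 1 0 (fun n => ⟨!![1, n; 0, 1], by simp⟩) fun n => ?_
    simp [Matrix.mulVec, dotProduct, Fin.sum_univ_two]
end
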